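/- Let d ≥ 1, let k ≥ 2 be an integer, and let s < 0. There exist constants C, δ, K > 0, depending only on d, k, s, such that the following holds. Let (u₀,u₁) be Schwartz functions on ℝ^d with ‖(u₀,u₁)‖_{F⃗L¹} ≤ 1 and ‖(u₀,u₁)‖_{𝓗⁰} ≤ 1, let A ≥ 1, N ≥ A/δ, R > 0, let φ be the function with φ̂ = R·𝟙_{Ω_k}, and set u⃗ := (u₀ + φ, u₁). Then for all t with K/N ≤ t ≤ δ: (i) ‖Ξ₀(u⃗)(t)‖_{H^s} ≤ C( R N^s A^{d/2} + 1 ); (ii) ‖Ξ₁(u⃗)(t)‖_{H^s} ≤ C( (t/N) Σ_{m=1}^k R^m A^{md} + t² ); (iii) ‖Ξ₂(u⃗)(t)‖_{H^s} ≤ C( (t/N)² Σ_{m=k+1}^{2k−1} R^m A^{md} + (t³/N) Σ_{m=1}^{k} R^m A^{md} + t⁴ ). -/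

import Mathlib

open MeasureTheory Real Set Filter Topology
open scoped ENNReal NNReal BigOperators

noncomputable section

/-- Frequency space `ℝ^d` with the Euclidean norm. -/
abbrev Edim (d : ℕ) := EuclideanSpace ℝ (Fin d)

/-! We work entirely on the Fourier side: a function `f` on `ℝ^d` is represented by
its Fourier transform `F = f̂ : ℝ^d → ℂ`. -/

/-- Squared `H^s` norm, computed on the Fourier side:
`‖f‖_{H^s}² = ∫ ⟨ξ⟩^{2s} |f̂(ξ)|² dξ`. -/
def HsNormSq (d : ℕ) (s : ℝ) (F : Edim d → ℂ) : ℝ≥0∞ :=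
  ∫⁻ ξ, ENNReal.ofReal ((1 + ‖ξ‖ ^ 2) ^ s * ‖F ξ‖ ^ 2)

/-- `H^s` norm on the Fourier side. -/
def HsNorm (d : ℕ) (s : ℝ) (F : Edim d → ℂ) : ℝ≥0∞ :=
  HsNormSq d s F ^ (1 / 2 : ℝ)

/-- Norm of `𝓗^s = H^s × H^{s-1}` on the Fourier side. -/
def pairHsNorm (d : ℕ) (s : ℝ) (F G : Edim d → ℂ) : ℝ≥0∞ :=
  (HsNormSq d s F + HsNormSq d (s - 1) G) ^ (1 / 2 : ℝ)

/-- Membership in `H^s`, on the Fourier side. -/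
def MemHs (d : ℕ) (s : ℝ) (F : Edim d → ℂ) : Prop :=
  Measurable F ∧ HsNormSq d s F < ⊤

/-- Membership in `𝓗^s = H^s × H^{s-1}`, on the Fourier side. -/
def MemHsPair (d : ℕ) (s : ℝ) (F G : Edim d → ℂ) : Prop :=
  MemHs d s F ∧ MemHs d (s - 1) G

/-- The Wiener-algebra norm `‖f‖_{FL^{0,1}} = ‖f̂‖_{L¹}`, on the Fourier side. -/
def FLNorm (d : ℕ) (F : Edim d → ℂ) : ℝ≥0∞ :=
  ∫⁻ ξ, (‖F ξ‖₊ : ℝ≥0∞)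

/-- The norm `‖g‖_{FL^{-1,1}} = ‖⟨ξ⟩⁻¹ ĝ‖_{L¹}`, on the Fourier side. -/
def FLm1Norm (d : ℕ) (F : Edim d → ℂ) : ℝ≥0∞ :=
  ∫⁻ ξ, ENNReal.ofReal ((1 + ‖ξ‖ ^ 2) ^ (-(1 : ℝ) / 2) * ‖F ξ‖)

/-- Norm of `F⃗L¹ = FL^{0,1} × FL^{-1,1}`. -/
def pairFLNorm (d : ℕ) (F G : Edim d → ℂ) : ℝ≥0∞ :=
  FLNorm d F + FLm1Norm d G

/-- Membership in `F⃗L¹ = FL^{0,1} × FL^{-1,1}`, on the Fourier side. -/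
def MemFLPair (d : ℕ) (F G : Edim d → ℂ) : Prop :=
  Measurable F ∧ Measurable G ∧ pairFLNorm d F G < ⊤

/-- Symbol of `V₀(t)`: `cos((√3/2)|ξ|t) + (1/√3) sin((√3/2)|ξ|t)`. -/
def V0sym (t r : ℝ) : ℝ :=
  Real.cos (Real.sqrt 3 / 2 * r * t) + 1 / Real.sqrt 3 * Real.sin (Real.sqrt 3 / 2 * r * t)

/-- Symbol of `V₁(t)`: `sin((√3/2)|ξ|t) / ((√3/2)|ξ|)`. -/
def V1sym (t r : ℝ) : ℝ :=
  Real.sin (Real.sqrt 3 / 2 * r * t) / (Real.sqrt 3 / 2 * r)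

/-- Symbol of the Poisson kernel `P(t)`: `e^{-|ξ|t/2}`. -/
def Psym (t r : ℝ) : ℝ := Real.exp (-(r * t) / 2)

/-- Symbol of `W(t) = P(t)V₁(t)`. -/
def Wsym (t r : ℝ) : ℝ := Psym t r * V1sym t r

/-- Fourier side of the linear flow `V(t)(u₀,u₁) = P(t)(V₀(t)u₀ + V₁(t)u₁)`. -/
def Vflow (d : ℕ) (F₀ F₁ : Edim d → ℂ) (t : ℝ) (ξ : Edim d) : ℂ :=
  ((Psym t ‖ξ‖ * V0sym t ‖ξ‖ : ℝ) : ℂ) * F₀ ξ + ((Psym t ‖ξ‖ * V1sym t ‖ξ‖ : ℝ) : ℂ) * F₁ ξ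

/-- Convolution on `ℝ^d`. -/
def conv (d : ℕ) (f g : Edim d → ℂ) (ξ : Edim d) : ℂ :=
  ∫ η, f (ξ - η) * g η

/-- `convIter d f n` is the `(n+1)`-fold convolution `f ∗ ⋯ ∗ f`. -/
def convIter (d : ℕ) (f : Edim d → ℂ) : ℕ → Edim d → ℂ
  | 0 => f
  | n + 1 => conv d (convIter d f n) f

/-- Convolution of a (nonempty) list of functions. -/
def listConv (d : ℕ) : List (Edim d → ℂ) → Edim d → ℂ
  | [] => fun _ => 0
  | f :: fs => fs.foldl (conv d) f

/-- Fourier side of the Duhamel operator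
`I_k(u₁,…,u_k)(t) = -∫₀ᵗ W(t-t') ∏ u_j(t') dt'`. -/
def Ik (d k : ℕ) (us : Fin k → ℝ → Edim d → ℂ) (t : ℝ) (ξ : Edim d) : ℂ :=
  -(∫ t' in (0 : ℝ)..t,
      ((Wsym (t - t') ‖ξ‖ : ℝ) : ℂ) * listConv d (List.ofFn fun i => us i t') ξ)

/-- Picard iterates `Ξ_j` of vNLW, on the Fourier side:
`Ξ₀(u⃗₀)(t) = V(t)u⃗₀` and
`Ξ_j(u⃗₀) = ∑_{j₁+⋯+j_k = j-1} I_k(Ξ_{j₁}(u⃗₀),…,Ξ_{j_k}(u⃗₀))`. -/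
def Xi (d k : ℕ) (F₀ F₁ : Edim d → ℂ) : ℕ → ℝ → Edim d → ℂ
  | 0 => Vflow d F₀ F₁
  | j + 1 => fun t ξ =>
      ∑ l ∈ (Finset.Nat.antidiagonalTuple k j).attach,
        Ik d k (fun i => Xi d k F₀ F₁ (l.1 i)) t ξ
  decreasing_by
    have h := Finset.Nat.mem_antidiagonalTuple.mp l.2
    have hle := Finset.single_le_sum (f := l.1) (fun j _ => Nat.zero_le (l.1 j))
      (Finset.mem_univ i)
    omega

/-- `u : [0,T] → FL^{0,1}(ℝ^d)` (represented on the Fourier side) is a Duhamel solution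
of vNLW with nonlinearity `-u^k` and initial data `(u₀,u₁)` with `û₀ = F₀`, `û₁ = F₁`. -/
structure IsDuhamelSolution (d k : ℕ) (T : ℝ) (F₀ F₁ : Edim d → ℂ)
    (u : ℝ → Edim d → ℂ) : Prop where
  measurable : ∀ t ∈ Set.Icc (0 : ℝ) T, Measurable (u t)
  finite : ∀ t ∈ Set.Icc (0 : ℝ) T, FLNorm d (u t) < ⊤
  continuous : ∀ t₀ ∈ Set.Icc (0 : ℝ) T, ∀ ε : ℝ, 0 < ε → ∃ δ : ℝ, 0 < δ ∧
    ∀ t ∈ Set.Icc (0 : ℝ) T, |t - t₀| < δ →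
      FLNorm d (fun ξ => u t ξ - u t₀ ξ) < ENNReal.ofReal ε
  duhamel : ∀ t ∈ Set.Icc (0 : ℝ) T, ∀ᵐ ξ : Edim d, u t ξ =
    ((Psym t ‖ξ‖ * V0sym t ‖ξ‖ : ℝ) : ℂ) * F₀ ξ
      + ((Psym t ‖ξ‖ * V1sym t ‖ξ‖ : ℝ) : ℂ) * F₁ ξ
      - ∫ t' in (0 : ℝ)..t,
          ((Wsym (t - t') ‖ξ‖ : ℝ) : ℂ) * convIter d (u t') (k - 1) ξ

/-- The cube `Q_A = [-A/8, A/8]^d`. -/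
def cubeSet (d : ℕ) (A : ℝ) : Set (Edim d) := {ξ | ∀ i, |ξ i| ≤ A / 8}

/-- `Ω = ⋃_{η ∈ Σ} (η + Q_A)` with `Σ = {-2Ne₁, -Ne₁, Ne₁, 2Ne₁}`. -/
def OmegaSet (d : ℕ) (N A : ℝ) : Set (Edim d) :=
  {ξ | ∃ c : ℝ, (c = -2 * N ∨ c = -N ∨ c = N ∨ c = 2 * N) ∧
    ∀ i : Fin d, |ξ i - (if (i : ℕ) = 0 then c else 0)| ≤ A / 8}

/-- `Ω_k = ⋃_{η ∈ Σ_k} (η + Q_A)` with `Σ_k = {-Ne₁, Ne₁}` for even `k` and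
`Σ_k = {-2Ne₁, -Ne₁, Ne₁, 2Ne₁}` for odd `k`. -/
def OmegaKSet (d k : ℕ) (N A : ℝ) : Set (Edim d) :=
  {ξ | ∃ c : ℝ, (if k % 2 = 0 then c = -N ∨ c = N
      else c = -2 * N ∨ c = -N ∨ c = N ∨ c = 2 * N) ∧
    ∀ i : Fin d, |ξ i - (if (i : ℕ) = 0 then c else 0)| ≤ A / 8}

/-- `φ̂ = R·𝟙_Ω`. -/
def phiHat (d : ℕ) (N A R : ℝ) : Edim d → ℂ :=
  Set.indicator (OmegaSet d N A) fun _ => (R : ℂ)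

/-- `φ̂ = R·𝟙_{Ω_k}`. -/
def phiHatK (d k : ℕ) (N A R : ℝ) : Edim d → ℂ :=
  Set.indicator (OmegaKSet d k N A) fun _ => (R : ℂ)

/-- `g_s(A)`: `1` if `s < -d/2`; `(log⟨A⟩)^{1/2}` if `s = -d/2`; `A^{d/2+s}` if `s > -d/2`. -/
def gs (d : ℕ) (s A : ℝ) : ℝ :=
  if s < -(d : ℝ) / 2 then 1
  else if s = -(d : ℝ) / 2 then Real.sqrt (Real.log (Real.sqrt (1 + A ^ 2)))
  else A ^ ((d : ℝ) / 2 + s)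


/-- The convolution of two nonnegative functions. -/
def nnConv {d : ℕ} (f g : Edim d → ℝ≥0∞) (ξ : Edim d) : ℝ≥0∞ := ∫⁻ η, f (ξ - η) * g η

/-- `f` has both its `L¹` and its `L²` norm bounded by `M`. -/
structure L1L2Bound {d : ℕ} (f : Edim d → ℝ≥0∞) (M : ℝ≥0∞) : Prop where
  measurable : Measurable f
  lintegral_le : ∫⁻ ξ, f ξ ≤ M
  lintegral_sq_le : ∫⁻ ξ, f ξ ^ 2 ≤ M ^ 2

theorem measurable_nnConv {d : ℕ} {f g : Edim d → ℝ≥0∞} (hf : Measurable f) (hg : Measurable g) :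
    Measurable (nnConv f g) := by
  unfold nnConv
  exact Measurable.lintegral_prod_right' (f := fun p : Edim d × Edim d => f (p.1 - p.2) * g p.2)
    (by fun_prop)

theorem lintegral_nnConv {d : ℕ} {f g : Edim d → ℝ≥0∞} (hf : Measurable f) (hg : Measurable g) :
    ∫⁻ ξ, nnConv f g ξ = (∫⁻ ξ, f ξ) * ∫⁻ ξ, g ξ := by
  unfold nnConv
  rw [lintegral_lintegral_swap (by fun_prop), ← lintegral_const_mul _ hg]
  refine lintegral_congr fun η => ?_
  rw [lintegral_mul_const _ (by fun_prop), lintegral_sub_right_eq_self f η]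

theorem sq_lintegral_mul_le {α : Type*} [MeasurableSpace α] {μ : Measure α} {f g : α → ℝ≥0∞}
    (hf : Measurable f) (hg : Measurable g) :
    (∫⁻ x, f x * g x ∂μ) ^ 2 ≤ (∫⁻ x, f x ^ 2 * g x ∂μ) * ∫⁻ x, g x ∂μ := by
  have hrpow : ∀ y : ℝ≥0∞, (y ^ (1 / 2 : ℝ)) ^ 2 = y := fun y => by
    rw [← ENNReal.rpow_natCast, ← ENNReal.rpow_mul]; norm_num
  have h := ENNReal.lintegral_mul_le_Lp_mul_Lq μ (p := 2) (q := 2) (by constructor <;> norm_num)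
    (f := fun x => f x * g x ^ (1 / 2 : ℝ)) (g := fun x => g x ^ (1 / 2 : ℝ))
    (by fun_prop) (by fun_prop)
  calc (∫⁻ x, f x * g x ∂μ) ^ 2
      = (∫⁻ x, ((fun x => f x * g x ^ (1 / 2 : ℝ)) * fun x => g x ^ (1 / 2 : ℝ)) x ∂μ) ^ 2 := by
        congr 1
        refine lintegral_congr fun x => ?_
        rw [Pi.mul_apply, mul_assoc, ← sq, hrpow]
    _ ≤ _ := pow_le_pow_left' h 2
    _ = _ := by
        rw [mul_pow, hrpow, hrpow]
        simp only [ENNReal.rpow_two, mul_pow, hrpow]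

theorem L1L2Bound.nnConv {d : ℕ} {f g : Edim d → ℝ≥0∞} {M M' : ℝ≥0∞}
    (hf : L1L2Bound f M) (hg : L1L2Bound g M') : L1L2Bound (nnConv f g) (M * M') where
  measurable := measurable_nnConv hf.measurable hg.measurable
  lintegral_le := by
    rw [lintegral_nnConv hf.measurable hg.measurable]
    exact mul_le_mul' hf.lintegral_le hg.lintegral_le
  lintegral_sq_le := by
    have hfm := hf.measurable
    calc ∫⁻ ξ, _root_.nnConv f g ξ ^ 2
        ≤ ∫⁻ ξ, _root_.nnConv (fun η => f η ^ 2) g ξ * ∫⁻ η, g η :=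
          lintegral_mono fun ξ => sq_lintegral_mul_le (by fun_prop) hg.measurable
      _ = (∫⁻ ξ, f ξ ^ 2) * (∫⁻ η, g η) * ∫⁻ η, g η := by
          rw [lintegral_mul_const _ (measurable_nnConv (by fun_prop) hg.measurable),
            lintegral_nnConv (by fun_prop) hg.measurable]
      _ ≤ M ^ 2 * M' * M' := by
          gcongr
          exacts [hf.lintegral_sq_le, hg.lintegral_le, hg.lintegral_le]
      _ = (M * M') ^ 2 := by ring

/-- The time-dependent function `f` is dominated on `[0,1]` by a finite sum of products of a
function of time and a function of frequency, and `h t` bounds the sum of the resulting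
`L¹ ∩ L²` norms. -/
def SeparatedBound {d : ℕ} (f : ℝ → Edim d → ℂ) (h : ℝ → ℝ≥0∞) : Prop :=
  ∃ (ι : Type) (_ : Fintype ι) (c : ι → ℝ → ℝ≥0∞) (g : ι → Edim d → ℝ≥0∞) (M : ι → ℝ≥0∞),
    (∀ i, Measurable (c i)) ∧ (∀ i, L1L2Bound (g i) (M i)) ∧
    (∀ t ∈ Icc (0 : ℝ) 1, ∀ ξ, ‖f t ξ‖ₑ ≤ ∑ i, c i t * g i ξ) ∧
    ∀ t ∈ Icc (0 : ℝ) 1, ∑ i, c i t * M i ≤ h t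

namespace SeparatedBound

variable {d : ℕ} {f f' : ℝ → Edim d → ℂ} {h h' : ℝ → ℝ≥0∞}

theorem mono (hf : SeparatedBound f h) (hh : ∀ t ∈ Icc (0 : ℝ) 1, h t ≤ h' t) :
    SeparatedBound f h' := by
  obtain ⟨ι, _, c, g, M, hc, hg, hfg, hM⟩ := hf
  exact ⟨ι, _, c, g, M, hc, hg, hfg, fun t ht => (hM t ht).trans (hh t ht)⟩

theorem zero : SeparatedBound (fun _ _ => 0 : ℝ → Edim d → ℂ) (fun _ => 0) :=
  ⟨Empty, inferInstance, fun _ _ => 0, fun _ _ => 0, fun _ => 0, by simp, by simp, by simp, by simp⟩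

theorem add (hf : SeparatedBound f h) (hf' : SeparatedBound f' h') :
    SeparatedBound (fun t ξ => f t ξ + f' t ξ) (fun t => h t + h' t) := by
  obtain ⟨ι, _, c, g, M, hc, hg, hfg, hM⟩ := hf
  obtain ⟨κ, _, c', g', M', hc', hg', hfg', hM'⟩ := hf'
  refine ⟨ι ⊕ κ, inferInstance, Sum.elim c c', Sum.elim g g', Sum.elim M M', ?_, ?_, ?_, ?_⟩
  · rintro (i | i) <;> simp [hc, hc']
  · rintro (i | i) <;> simp [hg, hg']
  · intro t ht ξ
    simpa using (enorm_add_le _ _).trans (add_le_add (hfg t ht ξ) (hfg' t ht ξ))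
  · intro t ht
    simpa using add_le_add (hM t ht) (hM' t ht)

theorem sum {α : Type*} (S : Finset α) {F : α → ℝ → Edim d → ℂ} {H : α → ℝ → ℝ≥0∞}
    (hF : ∀ a ∈ S, SeparatedBound (F a) (H a)) :
    SeparatedBound (fun t ξ => ∑ a ∈ S, F a t ξ) (fun t => ∑ a ∈ S, H a t) := by
  classical
  induction S using Finset.induction_on with
  | empty => simpa using zero
  | insert a S ha ih =>
    simp only [Finset.sum_insert ha]
    exact (hF a (Finset.mem_insert_self a S)).add
      (ih fun b hb => hF b (Finset.mem_insert_of_mem hb))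

theorem conv (hf : SeparatedBound f h) (hf' : SeparatedBound f' h') :
    SeparatedBound (fun t => _root_.conv d (f t) (f' t)) (fun t => h t * h' t) := by
  obtain ⟨ι, _, c, g, M, hc, hg, hfg, hM⟩ := hf
  obtain ⟨κ, _, c', g', M', hc', hg', hfg', hM'⟩ := hf'
  refine ⟨ι × κ, inferInstance, fun p t => c p.1 t * c' p.2 t, fun p => nnConv (g p.1) (g' p.2),
    fun p => M p.1 * M' p.2, fun p => (hc _).mul (hc' _), fun p => (hg _).nnConv (hg' _), ?_, ?_⟩
  · intro t ht ξ
    have hm : ∀ i j, Measurable fun η => g i (ξ - η) * g' j η := fun i j => by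
      have := (hg i).measurable
      have := (hg' j).measurable
      fun_prop
    calc ‖_root_.conv d (f t) (f' t) ξ‖ₑ
        ≤ ∫⁻ η, ‖f t (ξ - η) * f' t η‖ₑ := enorm_integral_le_lintegral_enorm _
      _ ≤ ∫⁻ η, ∑ p : ι × κ, c p.1 t * c' p.2 t * (g p.1 (ξ - η) * g' p.2 η) := by
          refine lintegral_mono fun η => ?_
          rw [enorm_mul]
          refine (mul_le_mul' (hfg t ht _) (hfg' t ht _)).trans_eq ?_
          rw [Finset.sum_mul_sum, Fintype.sum_prod_type]
          exact Finset.sum_congr rfl fun i _ => Finset.sum_congr rfl fun j _ => by ring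
      _ = ∑ p : ι × κ, c p.1 t * c' p.2 t * nnConv (g p.1) (g' p.2) ξ := by
          rw [lintegral_finsetSum _ fun p _ => (hm _ _).const_mul _]
          exact Finset.sum_congr rfl fun p _ => lintegral_const_mul _ (hm _ _)
  · intro t ht
    refine le_trans (le_of_eq ?_) (mul_le_mul' (hM t ht) (hM' t ht))
    rw [Finset.sum_mul_sum, Fintype.sum_prod_type]
    exact Finset.sum_congr rfl fun i _ => Finset.sum_congr rfl fun j _ => by ring

theorem foldl_conv (l : List ((ℝ → Edim d → ℂ) × (ℝ → ℝ≥0∞)))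
    (hl : ∀ p ∈ l, SeparatedBound p.1 p.2) (hf : SeparatedBound f h) :
    SeparatedBound (fun t => (l.map fun p => p.1 t).foldl (_root_.conv d) (f t))
      (fun t => h t * (l.map fun p => p.2 t).prod) := by
  induction l generalizing f h with
  | nil => simpa using hf
  | cons p l ih =>
    have := ih (fun q hq => hl q (List.mem_cons_of_mem _ hq)) (hf.conv (hl p List.mem_cons_self))
    simpa [mul_assoc] using this

theorem listConv {k : ℕ} {u : Fin k → ℝ → Edim d → ℂ} {H : Fin k → ℝ → ℝ≥0∞}
    (hu : ∀ i, SeparatedBound (u i) (H i)) :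
    SeparatedBound (fun t => _root_.listConv d (List.ofFn fun i => u i t))
      (fun t => ∏ i, H i t) := by
  cases k with
  | zero => simpa [_root_.listConv] using zero.mono fun _ _ => zero_le
  | succ k =>
    have := foldl_conv (List.ofFn fun i : Fin k => (u i.succ, H i.succ)) (by
      simp only [List.mem_ofFn]
      rintro _ ⟨i, rfl⟩
      exact hu _) (hu 0)
    simpa [_root_.listConv, List.ofFn_succ, List.map_ofFn, Function.comp_def, List.prod_ofFn,
      Fin.prod_univ_succ] using this

end SeparatedBound
theorem abs_Psym_le_one {t r : ℝ} (ht : 0 ≤ t) (hr : 0 ≤ r) : |Psym t r| ≤ 1 := by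
  rw [Psym, Real.abs_exp, Real.exp_le_one_iff]
  have := mul_nonneg hr ht
  linarith

theorem abs_V1sym_le {t r : ℝ} (ht : 0 ≤ t) (hr : 0 ≤ r) : |V1sym t r| ≤ t := by
  rcases hr.eq_or_lt with rfl | hr
  · simpa [V1sym] using ht
  have h3 : 0 < Real.sqrt 3 / 2 * r := by positivity
  rw [V1sym, abs_div, abs_of_pos h3, div_le_iff₀ h3]
  refine (Real.abs_sin_le_abs).trans_eq ?_
  rw [abs_of_nonneg (by positivity), mul_comm]

theorem abs_Wsym_le {t r : ℝ} (ht : 0 ≤ t) (hr : 0 ≤ r) : |Wsym t r| ≤ t := by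
  rw [Wsym, abs_mul]
  simpa using mul_le_mul (abs_Psym_le_one ht hr) (abs_V1sym_le ht hr) (abs_nonneg _) zero_le_one

theorem abs_V0sym_le {t r : ℝ} : |V0sym t r| ≤ 2 := by
  have h3 : 1 / Real.sqrt 3 ≤ 1 := by
    rw [div_le_one (by positivity)]
    exact Real.one_le_sqrt.mpr (by norm_num)
  calc |V0sym t r| ≤ |Real.cos (Real.sqrt 3 / 2 * r * t)|
        + |1 / Real.sqrt 3 * Real.sin (Real.sqrt 3 / 2 * r * t)| := abs_add_le _ _
    _ ≤ 1 + 1 * 1 := by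
        rw [abs_mul, abs_of_nonneg (by positivity : 0 ≤ 1 / Real.sqrt 3)]
        gcongr
        exacts [Real.abs_cos_le_one _, Real.abs_sin_le_one _]
    _ = 2 := by norm_num

theorem abs_V1sym_le_bracket {t r : ℝ} (ht : 0 ≤ t) (ht1 : t ≤ 1) (hr : 0 ≤ r) :
    |V1sym t r| ≤ 2 * (1 + r ^ 2) ^ (-(1 : ℝ) / 2) := by
  have h1 : |V1sym t r| ≤ 1 := (abs_V1sym_le ht hr).trans ht1
  have h2 : (V1sym t r * r) ^ 2 ≤ 4 / 3 := by
    rcases hr.eq_or_lt with rfl | hr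
    · norm_num
    have h3 : Real.sqrt 3 ^ 2 = 3 := Real.sq_sqrt (by norm_num)
    have h4 : (V1sym t r * r) ^ 2 = 4 / 3 * Real.sin (Real.sqrt 3 / 2 * r * t) ^ 2 := by
      rw [V1sym, div_mul_eq_mul_div, div_pow, mul_pow, mul_pow, div_pow, h3]
      field_simp
      ring_nf
    rw [h4]
    nlinarith [Real.sin_sq_le_one (Real.sqrt 3 / 2 * r * t)]
  have hpos : 0 < 1 + r ^ 2 := by positivity
  have h3 : V1sym t r ^ 2 ≤ 1 := by rwa [sq_le_one_iff_abs_le_one]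
  have hsq : |V1sym t r| * Real.sqrt (1 + r ^ 2) ≤ 2 := by
    refine le_of_sq_le_sq ?_ (by norm_num)
    rw [mul_pow, Real.sq_sqrt hpos.le, sq_abs]
    nlinarith
  rw [neg_div, Real.rpow_neg hpos.le, ← Real.sqrt_eq_rpow, ← div_eq_mul_inv,
    le_div_iff₀ (Real.sqrt_pos.mpr hpos)]
  exact hsq

namespace SeparatedBound

variable {d : ℕ} {f : ℝ → Edim d → ℂ} {h : ℝ → ℝ≥0∞}

theorem duhamel (hf : SeparatedBound f h) :
    SeparatedBound
      (fun t ξ => -(∫ t' in (0 : ℝ)..t, ((Wsym (t - t') ‖ξ‖ : ℝ) : ℂ) * f t' ξ))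
      (fun t => ENNReal.ofReal t * ∫⁻ t' in Ioc 0 t, h t') := by
  obtain ⟨ι, _, c, g, M, hc, hg, hfg, hM⟩ := hf
  refine ⟨ι, inferInstance, fun i t => ENNReal.ofReal t * ∫⁻ t' in Ioc 0 t, c i t', g, M, fun i => ?_, hg,
    ?_, ?_⟩
  · refine ENNReal.measurable_ofReal.mul (Monotone.measurable fun a b hab => ?_)
    exact lintegral_mono_set (Ioc_subset_Ioc_right hab)
  · intro t ht ξ
    rw [enorm_neg, intervalIntegral.integral_of_le ht.1]
    calc _ ≤ ∫⁻ t' in Ioc 0 t, ‖((Wsym (t - t') ‖ξ‖ : ℝ) : ℂ) * f t' ξ‖ₑ :=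
          enorm_integral_le_lintegral_enorm _
      _ ≤ ∫⁻ t' in Ioc 0 t, ∑ i, ENNReal.ofReal t * (c i t' * g i ξ) := by
          refine setLIntegral_mono' measurableSet_Ioc fun t' ht' => ?_
          rw [enorm_mul, ← Finset.mul_sum]
          refine mul_le_mul' ?_ (hfg t' ⟨ht'.1.le, ht'.2.trans ht.2⟩ ξ)
          rw [← ofReal_norm, Complex.norm_real, Real.norm_eq_abs]
          refine ENNReal.ofReal_le_ofReal ((abs_Wsym_le (by linarith [ht'.2]) (norm_nonneg _)).trans ?_)
          linarith [ht'.1]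
      _ = _ := by
          rw [lintegral_finsetSum _ fun i _ => ((hc i).mul_const _).const_mul _]
          refine Finset.sum_congr rfl fun i _ => ?_
          rw [lintegral_const_mul _ ((hc i).mul_const _), lintegral_mul_const _ (hc i), mul_assoc]
  · intro t ht
    calc ∑ i, ENNReal.ofReal t * (∫⁻ t' in Ioc 0 t, c i t') * M i
        = ENNReal.ofReal t * ∫⁻ t' in Ioc 0 t, ∑ i, c i t' * M i := by
          rw [lintegral_finsetSum _ fun i _ => (hc i).mul_const _, Finset.mul_sum]
          exact Finset.sum_congr rfl fun i _ => by rw [lintegral_mul_const _ (hc i), mul_assoc]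
      _ ≤ _ := by
          refine mul_le_mul' le_rfl ?_
          exact setLIntegral_mono' measurableSet_Ioc
            fun t' ht' => hM t' ⟨ht'.1.le, ht'.2.trans ht.2⟩

theorem Ik {k : ℕ} {u : Fin k → ℝ → Edim d → ℂ} {H : Fin k → ℝ → ℝ≥0∞}
    (hu : ∀ i, SeparatedBound (u i) (H i)) :
    SeparatedBound (_root_.Ik d k u)
      (fun t => ENNReal.ofReal t * ∫⁻ t' in Ioc 0 t, ∏ i, H i t') :=
  (listConv hu).duhamel

theorem Xi_succ {k j : ℕ} {F₀ F₁ : Edim d → ℂ} {H : ℕ → ℝ → ℝ≥0∞}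
    (hH : ∀ i ≤ j, SeparatedBound (Xi d k F₀ F₁ i) (H i)) :
    SeparatedBound (Xi d k F₀ F₁ (j + 1))
      (fun t => ∑ l ∈ Finset.Nat.antidiagonalTuple k j,
        ENNReal.ofReal t * ∫⁻ t' in Ioc 0 t, ∏ i, H (l i) t') := by
  have := sum (Finset.Nat.antidiagonalTuple k j).attach
    (F := fun l => _root_.Ik d k (fun i => Xi d k F₀ F₁ (l.1 i)))
    (H := fun l t => ENNReal.ofReal t * ∫⁻ t' in Ioc 0 t, ∏ i, H (l.1 i) t')
    (fun l _ => SeparatedBound.Ik fun i => hH _ ?_)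
  · rw [Xi]
    refine this.mono fun t _ => le_of_eq ?_
    exact Finset.sum_attach _ fun l : Fin k → ℕ =>
      ENNReal.ofReal t * ∫⁻ t' in Ioc 0 t, ∏ i, H (l i) t'
  · have h := Finset.Nat.mem_antidiagonalTuple.mp l.2
    have hle := Finset.single_le_sum (f := l.1) (fun j _ => Nat.zero_le (l.1 j))
      (Finset.mem_univ i)
    omega

end SeparatedBound

theorem lintegral_sq_sum_le {α ι : Type*} [MeasurableSpace α] {μ : Measure α} (S : Finset ι)
    {g : ι → α → ℝ≥0∞} (hg : ∀ i ∈ S, Measurable (g i)) :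
    (∫⁻ x, (∑ i ∈ S, g i x) ^ 2 ∂μ) ^ (1 / 2 : ℝ) ≤
      ∑ i ∈ S, (∫⁻ x, g i x ^ 2 ∂μ) ^ (1 / 2 : ℝ) := by
  classical
  induction S using Finset.induction_on with
  | empty => simp
  | insert a S ha ih =>
    simp only [Finset.sum_insert ha]
    have h := ENNReal.lintegral_Lp_add_le (μ := μ) (p := 2) (f := g a) (g := fun x => ∑ i ∈ S, g i x)
      (hg a (Finset.mem_insert_self a S)).aemeasurable
      (Finset.measurable_fun_sum S fun i hi => hg i (Finset.mem_insert_of_mem hi)).aemeasurable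
      (by norm_num)
    simp only [ENNReal.rpow_two, Pi.add_apply] at h
    exact h.trans (add_le_add_right (ih fun i hi => hg i (Finset.mem_insert_of_mem hi)) _)

theorem HsNorm_le_of_weight_mul_enorm_le {d : ℕ} {s : ℝ} {F : Edim d → ℂ} {G : Edim d → ℝ≥0∞}
    (hFG : ∀ ξ, ENNReal.ofReal ((1 + ‖ξ‖ ^ 2) ^ (s / 2)) * ‖F ξ‖ₑ ≤ G ξ) :
    HsNorm d s F ≤ (∫⁻ ξ, G ξ ^ 2) ^ (1 / 2 : ℝ) := by
  refine ENNReal.rpow_le_rpow (lintegral_mono fun ξ => ?_) (by norm_num)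
  refine le_trans (le_of_eq ?_) (pow_le_pow_left' (hFG ξ) 2)
  have hpos : 0 ≤ 1 + ‖ξ‖ ^ 2 := by positivity
  rw [← ofReal_norm, ← ENNReal.ofReal_mul (by positivity), ← ENNReal.ofReal_pow (by positivity),
    mul_pow, ← Real.rpow_natCast ((1 + ‖ξ‖ ^ 2) ^ (s / 2)), ← Real.rpow_mul hpos]
  norm_num

theorem weight_mul_le {d : ℕ} {s : ℝ} (hs : s ≤ 0) (ξ : Edim d) (x : ℝ≥0∞) :
    ENNReal.ofReal ((1 + ‖ξ‖ ^ 2) ^ (s / 2)) * x ≤ x := by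
  refine mul_le_of_le_one_left zero_le (ENNReal.ofReal_le_one.mpr ?_)
  exact Real.rpow_le_one_of_one_le_of_nonpos (by nlinarith [sq_nonneg ‖ξ‖]) (by linarith)

theorem SeparatedBound.HsNorm_le {d : ℕ} {f : ℝ → Edim d → ℂ} {h : ℝ → ℝ≥0∞}
    (hf : SeparatedBound f h) {s : ℝ} (hs : s ≤ 0) {t : ℝ} (ht : t ∈ Icc (0 : ℝ) 1) :
    HsNorm d s (f t) ≤ h t := by
  obtain ⟨ι, _, c, g, M, hc, hg, hfg, hM⟩ := hf
  refine (HsNorm_le_of_weight_mul_enorm_le fun ξ => (weight_mul_le hs ξ _).trans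
    (hfg t ht ξ)).trans (le_trans ?_ (hM t ht))
  refine (lintegral_sq_sum_le _ fun i _ => ((hg i).measurable).const_mul _).trans ?_
  refine Finset.sum_le_sum fun i _ => ?_
  simp only [mul_pow]
  rw [lintegral_const_mul _ ((hg i).measurable.pow_const 2)]
  calc _ ≤ (c i t ^ 2 * M i ^ 2) ^ (1 / 2 : ℝ) := by
        gcongr
        exact (hg i).lintegral_sq_le
    _ = c i t * M i := by
        rw [← mul_pow, ← ENNReal.rpow_natCast, ← ENNReal.rpow_mul]; norm_num
theorem SeparatedBound.single {d : ℕ} {f : ℝ → Edim d → ℂ} {c : ℝ → ℝ≥0∞} {g : Edim d → ℝ≥0∞}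
    {M : ℝ≥0∞} (hc : Measurable c) (hg : L1L2Bound g M)
    (hf : ∀ t ∈ Icc (0 : ℝ) 1, ∀ ξ, ‖f t ξ‖ₑ ≤ c t * g ξ) :
    SeparatedBound f (fun t => c t * M) :=
  ⟨Unit, inferInstance, fun _ => c, fun _ => g, fun _ => M, fun _ => hc, fun _ => hg,
    by simpa using hf, by simp⟩

theorem SeparatedBound.Vflow {d : ℕ} {F₀ F₁ : Edim d → ℂ} (hF₀ : Measurable F₀)
    (hF₁ : Measurable F₁) (hFL : pairFLNorm d F₀ F₁ ≤ 1) (hHs : pairHsNorm d 0 F₀ F₁ ≤ 1) :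
    SeparatedBound (_root_.Vflow d F₀ F₁) (fun _ => 4) := by
  have hHs' : HsNormSq d 0 F₀ + HsNormSq d (0 - 1) F₁ ≤ 1 := by
    rwa [pairHsNorm, ← ENNReal.one_rpow (1 / 2 : ℝ),
      ENNReal.rpow_le_rpow_iff (by norm_num)] at hHs
  have h₀ : L1L2Bound (fun ξ => ‖F₀ ξ‖ₑ) 1 := by
    refine ⟨by fun_prop, le_self_add.trans hFL, le_trans (le_of_eq ?_)
      ((le_self_add.trans hHs').trans_eq (one_pow 2).symm)⟩
    refine lintegral_congr fun ξ => ?_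
    rw [Real.rpow_zero, one_mul, ENNReal.ofReal_pow (norm_nonneg _), ofReal_norm]
  have h₁ : L1L2Bound (fun ξ => ENNReal.ofReal ((1 + ‖ξ‖ ^ 2) ^ (-(1 : ℝ) / 2) * ‖F₁ ξ‖)) 1 := by
    refine ⟨by fun_prop, le_add_self.trans hFL, le_trans (le_of_eq ?_)
      ((le_add_self.trans hHs').trans_eq (one_pow 2).symm)⟩
    refine lintegral_congr fun ξ => ?_
    have hpos : 0 ≤ 1 + ‖ξ‖ ^ 2 := by positivity
    rw [← ENNReal.ofReal_pow (by positivity), mul_pow,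
      ← Real.rpow_natCast ((1 + ‖ξ‖ ^ 2) ^ (-(1 : ℝ) / 2)), ← Real.rpow_mul hpos]
    norm_num
  refine ((SeparatedBound.single (c := fun _ => ENNReal.ofReal 2)
      (f := fun t ξ => ((Psym t ‖ξ‖ * V0sym t ‖ξ‖ : ℝ) : ℂ) * F₀ ξ) (by fun_prop) h₀ ?_).add
    (SeparatedBound.single (c := fun _ => ENNReal.ofReal 2)
      (f := fun t ξ => ((Psym t ‖ξ‖ * V1sym t ‖ξ‖ : ℝ) : ℂ) * F₁ ξ) (by fun_prop) h₁ ?_)).mono ?_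
  · intro t ht ξ
    rw [enorm_mul]
    gcongr
    rw [← ofReal_norm, Complex.norm_real, Real.norm_eq_abs, abs_mul]
    refine ENNReal.ofReal_le_ofReal ?_
    simpa using mul_le_mul (abs_Psym_le_one ht.1 (norm_nonneg ξ)) abs_V0sym_le (abs_nonneg _)
      zero_le_one
  · intro t ht ξ
    rw [← ofReal_norm, norm_mul, Complex.norm_real, Real.norm_eq_abs, abs_mul,
      ← ENNReal.ofReal_mul (by norm_num),
      ← mul_assoc]
    refine ENNReal.ofReal_le_ofReal (mul_le_mul_of_nonneg_right ?_ (norm_nonneg _))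
    refine (mul_le_of_le_one_left (abs_nonneg _) (abs_Psym_le_one ht.1 (norm_nonneg ξ))).trans ?_
    exact abs_V1sym_le_bracket ht.1 ht.2 (norm_nonneg _)
  · intro t _
    norm_num

/-- The cube of side `A/4` centred at `c e₁`. -/
def shiftedCube (d : ℕ) (A c : ℝ) : Set (Edim d) :=
  {ξ | ∀ i : Fin d, |ξ i - (if (i : ℕ) = 0 then c else 0)| ≤ A / 8}

theorem measurableSet_shiftedCube (d : ℕ) (A c : ℝ) : MeasurableSet (shiftedCube d A c) := by
  have : shiftedCube d A c =
      ⋂ i : Fin d, {ξ : Edim d | |ξ i - (if (i : ℕ) = 0 then c else 0)| ≤ A / 8} := by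
    ext; simp [shiftedCube]
  rw [this]
  exact MeasurableSet.iInter fun i => measurableSet_le (by fun_prop) measurable_const

theorem volume_shiftedCube {d : ℕ} {A : ℝ} (hA : 0 ≤ A) (c : ℝ) :
    volume (shiftedCube d A c) = ENNReal.ofReal ((A / 4) ^ d) := by
  have h : shiftedCube d A c = (@WithLp.ofLp 2 (Fin d → ℝ)) ⁻¹'
      Metric.closedBall (fun i : Fin d => if (i : ℕ) = 0 then c else 0) (A / 8) := by
    ext ξ
    simp [shiftedCube, dist_pi_le_iff (by positivity : 0 ≤ A / 8), Real.dist_eq]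
  rw [h, (PiLp.volume_preserving_ofLp (Fin d)).measure_preimage
    Metric.isClosed_closedBall.measurableSet.nullMeasurableSet,
    Real.volume_pi_closedBall _ (by positivity), Fintype.card_fin]
  congr 2
  ring

theorem OmegaSet_eq (d : ℕ) (N A : ℝ) : OmegaSet d N A =
    shiftedCube d A (-2 * N) ∪ (shiftedCube d A (-N) ∪
      (shiftedCube d A N ∪ shiftedCube d A (2 * N))) := by
  ext ξ
  simp [OmegaSet, shiftedCube, or_and_right, exists_or]

theorem measurableSet_OmegaSet (d : ℕ) (N A : ℝ) : MeasurableSet (OmegaSet d N A) := by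
  rw [OmegaSet_eq]
  exact (measurableSet_shiftedCube d A _).union ((measurableSet_shiftedCube d A _).union
    ((measurableSet_shiftedCube d A _).union (measurableSet_shiftedCube d A _)))

theorem volume_OmegaSet_le {d : ℕ} (hd : 1 ≤ d) (N : ℝ) {A : ℝ} (hA : 0 ≤ A) :
    volume (OmegaSet d N A) ≤ ENNReal.ofReal (A ^ d) := by
  rw [OmegaSet_eq]
  refine (measure_union_le _ _).trans ((add_le_add_right ((measure_union_le _ _).trans
    (add_le_add_right (measure_union_le _ _) _)) _).trans ?_)
  simp only [volume_shiftedCube hA]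
  have h0 : 0 ≤ (A / 4) ^ d := by positivity
  rw [← ENNReal.ofReal_add h0 h0, ← ENNReal.ofReal_add h0 (by positivity),
    ← ENNReal.ofReal_add h0 (by positivity)]
  refine ENNReal.ofReal_le_ofReal ?_
  have h4 : (4 : ℝ) ≤ 4 ^ d := le_self_pow₀ (by norm_num) (by omega)
  have : A ^ d = 4 ^ d * (A / 4) ^ d := by rw [← mul_pow]; congr 1; ring
  nlinarith

theorem OmegaKSet_subset_OmegaSet (d k : ℕ) (N A : ℝ) : OmegaKSet d k N A ⊆ OmegaSet d N A := by
  rintro ξ ⟨c, hc, hξ⟩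
  refine ⟨c, ?_, hξ⟩
  split_ifs at hc <;> tauto

theorem half_le_norm_of_mem_OmegaSet {d : ℕ} (hd : 1 ≤ d) {N A : ℝ} (hN : 0 ≤ N) (hAN : A ≤ N)
    {ξ : Edim d} (hξ : ξ ∈ OmegaSet d N A) : N / 2 ≤ ‖ξ‖ := by
  obtain ⟨c, hc, hξ⟩ := hξ
  have h := hξ ⟨0, hd⟩
  have hc' : N ≤ |c| := by
    rcases hc with rfl | rfl | rfl | rfl <;> first
      | exact (by linarith : N ≤ -(-2 * N)).trans (neg_le_abs _)
      | exact (by linarith : N ≤ -(-N)).trans (neg_le_abs _)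
      | exact le_abs_self _
      | exact (by linarith : N ≤ 2 * N).trans (le_abs_self _)
  simp only [if_true] at h
  have h1 := abs_sub_abs_le_abs_sub c (ξ ⟨0, hd⟩)
  rw [abs_sub_comm] at h1
  have h2 := PiLp.norm_apply_le ξ ⟨0, hd⟩
  rw [Real.norm_eq_abs] at h2
  linarith

/-- The majorant `R·𝟙_Ω` of `|φ̂|`. -/
def phiMajorant (d : ℕ) (N A R : ℝ) : Edim d → ℝ≥0∞ :=
  (OmegaSet d N A).indicator fun _ => ENNReal.ofReal R

theorem measurable_phiMajorant (d : ℕ) (N A R : ℝ) : Measurable (phiMajorant d N A R) :=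
  measurable_const.indicator (measurableSet_OmegaSet d N A)

theorem lintegral_phiMajorant_sq_le {d : ℕ} (hd : 1 ≤ d) (N : ℝ) {A R : ℝ} (hA : 0 ≤ A)
    (hR : 0 ≤ R) : ∫⁻ ξ, phiMajorant d N A R ξ ^ 2 ≤ ENNReal.ofReal (R ^ 2 * A ^ d) := by
  have : ∀ ξ, phiMajorant d N A R ξ ^ 2 =
      (OmegaSet d N A).indicator (fun _ => ENNReal.ofReal R ^ 2) ξ := fun ξ => by
    by_cases h : ξ ∈ OmegaSet d N A <;> simp [phiMajorant, h]
  simp_rw [this]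
  rw [lintegral_indicator_const (measurableSet_OmegaSet d N A), ENNReal.ofReal_mul (by positivity),
    ENNReal.ofReal_pow hR]
  gcongr
  exact volume_OmegaSet_le hd N hA

theorem L1L2Bound_phiMajorant {d : ℕ} (hd : 1 ≤ d) (N : ℝ) {A R : ℝ} (hA : 1 ≤ A) (hR : 0 ≤ R) :
    L1L2Bound (phiMajorant d N A R) (ENNReal.ofReal (R * A ^ d)) where
  measurable := measurable_phiMajorant d N A R
  lintegral_le := by
    rw [phiMajorant, lintegral_indicator_const (measurableSet_OmegaSet d N A),
      ENNReal.ofReal_mul hR]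
    gcongr
    exact volume_OmegaSet_le hd N (by linarith)
  lintegral_sq_le := by
    refine (lintegral_phiMajorant_sq_le hd N (by linarith) hR).trans ?_
    rw [← ENNReal.ofReal_pow (by positivity)]
    refine ENNReal.ofReal_le_ofReal ?_
    rw [mul_pow]
    gcongr
    exact le_self_pow₀ (one_le_pow₀ hA) two_ne_zero

theorem enorm_Vflow_phiHatK_le {d : ℕ} (hd : 1 ≤ d) (k : ℕ) {N A R t : ℝ} (hN : 0 ≤ N)
    (hAN : A ≤ N) (hR : 0 ≤ R) (ht : 0 ≤ t) (ξ : Edim d) :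
    ‖Vflow d (phiHatK d k N A R) (fun _ => 0) t ξ‖ₑ ≤
      ENNReal.ofReal (2 * Real.exp (-(N / 4) * t)) * phiMajorant d N A R ξ := by
  by_cases h : ξ ∈ OmegaKSet d k N A
  · have hΩ := OmegaKSet_subset_OmegaSet d k N A h
    have hξ := half_le_norm_of_mem_OmegaSet hd hN hAN hΩ
    simp only [Vflow, mul_zero, add_zero, phiHatK, phiMajorant, indicator_of_mem h,
      indicator_of_mem hΩ]
    rw [← ofReal_norm, norm_mul, Complex.norm_real, Complex.norm_real, Real.norm_eq_abs,
      Real.norm_eq_abs, abs_mul, abs_of_nonneg hR, ← ENNReal.ofReal_mul (by positivity)]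
    refine ENNReal.ofReal_le_ofReal (mul_le_mul_of_nonneg_right ?_ hR)
    rw [mul_comm (2 : ℝ)]
    refine mul_le_mul ?_ abs_V0sym_le (abs_nonneg _) (Real.exp_pos _).le
    rw [Psym, Real.abs_exp]
    refine Real.exp_le_exp.mpr ?_
    nlinarith
  · simp [Vflow, phiHatK, h]

theorem Vflow_add_left {d : ℕ} (F G F₁ : Edim d → ℂ) (t : ℝ) (ξ : Edim d) :
    Vflow d (fun ξ => F ξ + G ξ) F₁ t ξ = Vflow d F F₁ t ξ + Vflow d G (fun _ => 0) t ξ := by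
  simp only [Vflow]
  ring

theorem SeparatedBound.Vflow_add_phiHatK {d : ℕ} (hd : 1 ≤ d) (k : ℕ) {F₀ F₁ : Edim d → ℂ}
    (hF : SeparatedBound (_root_.Vflow d F₀ F₁) (fun _ => 4))
    {N A R : ℝ} (hA : 1 ≤ A) (hAN : A ≤ N) (hR : 0 ≤ R) :
    SeparatedBound (_root_.Vflow d (fun ξ => F₀ ξ + phiHatK d k N A R ξ) F₁)
      (fun t => ENNReal.ofReal (4 * (1 + R * A ^ d * Real.exp (-(N / 4) * t)))) := by
  have h := hF.add (SeparatedBound.single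
    (c := fun t => ENNReal.ofReal (2 * Real.exp (-(N / 4) * t)))
    (by fun_prop) (L1L2Bound_phiMajorant hd N hA hR)
    fun t ht ξ => enorm_Vflow_phiHatK_le hd k (by linarith) hAN hR ht.1 ξ)
  simp only [← Vflow_add_left] at h
  refine h.mono fun t _ => ?_
  rw [show (4 : ℝ≥0∞) = ENNReal.ofReal 4 by norm_num, ← ENNReal.ofReal_mul (by positivity),
    ← ENNReal.ofReal_add (by norm_num) (by positivity)]
  refine ENNReal.ofReal_le_ofReal ?_
  have : 0 ≤ R * A ^ d * Real.exp (-(N / 4) * t) := by positivity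
  linarith

theorem HsNorm_Vflow_add_phiHatK_le {d : ℕ} (hd : 1 ≤ d) (k : ℕ) {F₀ F₁ : Edim d → ℂ}
    (hF : SeparatedBound (Vflow d F₀ F₁) (fun _ => 4)) (hm : Measurable F₀) (hm₁ : Measurable F₁)
    {s N A R t : ℝ} (hs : s ≤ 0) (hA : 1 ≤ A) (hAN : A ≤ N) (hR : 0 ≤ R)
    (ht : t ∈ Icc (0 : ℝ) 1) :
    HsNorm d s (Vflow d (fun ξ => F₀ ξ + phiHatK d k N A R ξ) F₁ t) ≤
      ENNReal.ofReal (4 + 2 * (N / 2) ^ s * (R * A ^ ((d : ℝ) / 2))) := by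
  have hN : 0 < N := by linarith
  have hweight : ∀ ξ, ENNReal.ofReal ((1 + ‖ξ‖ ^ 2) ^ (s / 2)) * phiMajorant d N A R ξ ≤
      ENNReal.ofReal ((N / 2) ^ s) * phiMajorant d N A R ξ := fun ξ => by
    by_cases h : ξ ∈ OmegaSet d N A
    · gcongr
      have hξ := half_le_norm_of_mem_OmegaSet hd hN.le hAN h
      have : (N / 2) ^ s = ((N / 2) ^ 2) ^ (s / 2) := by
        rw [← Real.rpow_natCast, ← Real.rpow_mul (by positivity)]
        congr 1
        push_cast
        ring
      rw [this]
      refine Real.rpow_le_rpow_of_nonpos (by positivity) ?_ (by linarith)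
      nlinarith
    · simp [phiMajorant, h]
  set w : Edim d → ℝ≥0∞ := fun ξ => ENNReal.ofReal ((1 + ‖ξ‖ ^ 2) ^ (s / 2)) with hw
  have hVm : Measurable (Vflow d F₀ F₁ t) := by
    unfold Vflow Psym V0sym V1sym
    fun_prop
  refine (HsNorm_le_of_weight_mul_enorm_le (G := (fun ξ => w ξ * ‖Vflow d F₀ F₁ t ξ‖ₑ) +
    fun ξ => ENNReal.ofReal (2 * (N / 2) ^ s) * phiMajorant d N A R ξ) fun ξ => ?_).trans ?_
  · rw [Vflow_add_left, Pi.add_apply]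
    refine (mul_le_mul' le_rfl (enorm_add_le _ _)).trans ?_
    rw [mul_add]
    refine add_le_add le_rfl ?_
    refine (mul_le_mul' le_rfl (enorm_Vflow_phiHatK_le hd k hN.le hAN hR ht.1 ξ)).trans ?_
    rw [mul_left_comm, ENNReal.ofReal_mul (by norm_num : (0 : ℝ) ≤ 2) (q := (N / 2) ^ s), mul_assoc]
    refine mul_le_mul' (ENNReal.ofReal_le_ofReal ?_) (hweight ξ)
    have : Real.exp (-(N / 4) * t) ≤ 1 := Real.exp_le_one_iff.mpr (by nlinarith [ht.1])
    linarith
  · have h := ENNReal.lintegral_Lp_add_le (μ := volume) (p := 2)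
      (f := fun ξ => w ξ * ‖Vflow d F₀ F₁ t ξ‖ₑ)
      (g := fun ξ => ENNReal.ofReal (2 * (N / 2) ^ s) * phiMajorant d N A R ξ)
      (by fun_prop) ((measurable_phiMajorant d N A R).const_mul _).aemeasurable (by norm_num)
    simp only [ENNReal.rpow_two] at h
    refine h.trans ?_
    rw [ENNReal.ofReal_add (by norm_num) (by positivity)]
    refine add_le_add ?_ ?_
    · have h4 := hF.HsNorm_le hs ht
      rw [show ENNReal.ofReal 4 = 4 by norm_num]
      refine le_trans (le_of_eq ?_) h4
      unfold HsNorm HsNormSq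
      congr 1
      refine lintegral_congr fun ξ => ?_
      have hpos : 0 ≤ 1 + ‖ξ‖ ^ 2 := by positivity
      rw [hw, ← ofReal_norm, ← ENNReal.ofReal_mul (by positivity),
        ← ENNReal.ofReal_pow (by positivity), mul_pow,
        ← Real.rpow_natCast ((1 + ‖ξ‖ ^ 2) ^ (s / 2)), ← Real.rpow_mul hpos]
      norm_num
    · simp only [mul_pow]
      rw [lintegral_const_mul _ ((measurable_phiMajorant d N A R).pow_const 2)]
      refine (ENNReal.rpow_le_rpow (mul_le_mul' le_rfl
        (lintegral_phiMajorant_sq_le hd N (by linarith) hR)) (by norm_num)).trans_eq ?_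
      rw [← ENNReal.ofReal_pow (by positivity), ← ENNReal.ofReal_mul (by positivity),
        ENNReal.ofReal_rpow_of_nonneg (by positivity) (by norm_num), ← Real.sqrt_eq_rpow,
        Real.sqrt_mul (by positivity), Real.sqrt_mul (by positivity), Real.sqrt_sq (by positivity),
        Real.sqrt_sq hR, Real.sqrt_eq_rpow, ← Real.rpow_natCast, ← Real.rpow_mul (by linarith)]
      congr 5
      ring
theorem lintegral_ofReal_add_mul_exp_le {p q a t : ℝ} (hp : 0 ≤ p) (hq : 0 ≤ q) (ha : 0 < a)
    (ht : 0 ≤ t) :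
    ∫⁻ x in Ioc 0 t, ENNReal.ofReal (p + q * Real.exp (-a * x)) ≤
      ENNReal.ofReal (p * t + q / a) := by
  have hcont : Continuous fun x => p + q * Real.exp (-a * x) := by fun_prop
  rw [← ofReal_integral_eq_lintegral_ofReal
      ((hcont.integrableOn_Icc (a := 0) (b := t)).mono_set Ioc_subset_Icc_self)
      (Eventually.of_forall fun x => by positivity),
    ← intervalIntegral.integral_of_le ht,
    intervalIntegral.integral_eq_sub_of_hasDerivAt
      (f := fun x => p * x - q / a * Real.exp (-a * x)) (fun x _ => ?_)
      (hcont.intervalIntegrable _ _)]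
  · refine ENNReal.ofReal_le_ofReal ?_
    have : 0 ≤ q / a * Real.exp (-a * t) := by positivity
    simp only [mul_zero, Real.exp_zero]
    linarith
  · have h := ((hasDerivAt_id x).const_mul p).sub
      ((((hasDerivAt_id x).const_mul (-a)).exp).const_mul (q / a))
    refine h.congr_deriv ?_
    simp only [id]
    field_simp
    ring

theorem one_add_mul_pow_le {B E : ℝ} (hB : 0 ≤ B) (hE : 0 ≤ E) (hE1 : E ≤ 1) (n : ℕ) :
    (1 + B * E) ^ n ≤ 2 ^ n * (1 + (∑ m ∈ Finset.Icc 1 n, B ^ m) * E) := by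
  have hsum : 0 ≤ ∑ m ∈ Finset.Icc 1 n, B ^ m := Finset.sum_nonneg fun m _ => by positivity
  rcases n.eq_zero_or_pos with rfl | hn
  · simp
  rcases le_total (B * E) 1 with h | h
  · calc (1 + B * E) ^ n ≤ 2 ^ n := by gcongr; linarith
      _ ≤ _ := le_mul_of_one_le_right (by positivity) (by nlinarith)
  · calc (1 + B * E) ^ n ≤ (2 * (B * E)) ^ n := by gcongr; linarith
      _ = 2 ^ n * (B ^ n * E ^ n) := by ring
      _ ≤ 2 ^ n * ((∑ m ∈ Finset.Icc 1 n, B ^ m) * E) := by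
          gcongr
          · exact Finset.single_le_sum (f := fun m => B ^ m) (fun m _ => by positivity)
              (Finset.mem_Icc.mpr ⟨hn, le_rfl⟩)
          · exact pow_le_of_le_one hE hE1 hn.ne'
      _ ≤ _ := by gcongr; linarith

theorem sum_pow_mul_sum_pow_le {B : ℝ} (hB : 0 ≤ B) (k : ℕ) :
    (∑ m ∈ Finset.Icc 1 k, B ^ m) * ∑ m ∈ Finset.Icc 1 (k - 1), B ^ m ≤
      (k : ℝ) ^ 2 * (∑ m ∈ Finset.Icc 1 k, B ^ m +
        ∑ m ∈ Finset.Icc (k + 1) (2 * k - 1), B ^ m) := by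
  have hS : ∀ a b : ℕ, 0 ≤ ∑ m ∈ Finset.Icc a b, B ^ m := fun a b =>
    Finset.sum_nonneg fun m _ => by positivity
  set T := ∑ m ∈ Finset.Icc 1 k, B ^ m + ∑ m ∈ Finset.Icc (k + 1) (2 * k - 1), B ^ m with hT
  have hT0 : 0 ≤ T := add_nonneg (hS _ _) (hS _ _)
  have hterm : ∀ i ∈ Finset.Icc 1 k, ∀ j ∈ Finset.Icc 1 (k - 1), B ^ i * B ^ j ≤ T := by
    intro i hi j hj
    rw [Finset.mem_Icc] at hi hj
    rw [← pow_add]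
    rcases le_or_gt (i + j) k with h | h
    · exact (Finset.single_le_sum (f := fun m => B ^ m) (fun m _ => by positivity)
        (Finset.mem_Icc.mpr ⟨by omega, h⟩)).trans (le_add_of_nonneg_right (hS _ _))
    · exact (Finset.single_le_sum (f := fun m => B ^ m) (fun m _ => by positivity)
        (Finset.mem_Icc.mpr ⟨by omega, by omega⟩)).trans (le_add_of_nonneg_left (hS _ _))
  rw [Finset.sum_mul_sum]
  calc _ ≤ ∑ i ∈ Finset.Icc 1 k, ∑ j ∈ Finset.Icc 1 (k - 1), T :=
        Finset.sum_le_sum fun i hi => Finset.sum_le_sum fun j hj => hterm i hi j hj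
    _ = (k : ℝ) * (((k - 1 : ℕ) : ℝ) * T) := by simp
    _ ≤ (k : ℝ) * ((k : ℝ) * T) := by
        gcongr
        omega
    _ = _ := by ring

theorem mul_exp_le {a x : ℝ} (ha : 0 < a) :
    x * Real.exp (-(2 * a) * x) ≤ 1 / a * Real.exp (-a * x) := by
  have h := Real.add_one_le_exp (a * x)
  have h2 : Real.exp (-a * x) = Real.exp (a * x) * Real.exp (-(2 * a) * x) := by
    rw [← Real.exp_add]; congr 1; ring
  rw [h2, ← mul_assoc]
  gcongr
  rw [div_mul_eq_mul_div, le_div_iff₀ ha]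
  linarith

theorem sq_mul_exp_le {a x : ℝ} (ha : 0 < a) (hx : 0 ≤ x) :
    x ^ 2 * Real.exp (-(2 * a) * x) ≤ 2 / a ^ 2 * Real.exp (-a * x) := by
  have h := Real.quadratic_le_exp_of_nonneg (mul_nonneg ha.le hx)
  have h2 : Real.exp (-a * x) = Real.exp (a * x) * Real.exp (-(2 * a) * x) := by
    rw [← Real.exp_add]; congr 1; ring
  rw [h2, ← mul_assoc]
  gcongr
  rw [div_mul_eq_mul_div, le_div_iff₀ (by positivity)]
  nlinarith [mul_nonneg ha.le hx]

theorem prod_apply_of_mem_antidiagonalTuple_one {α : Type*} [CommMonoid α] {k : ℕ}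
    {l : Fin k → ℕ} (hl : l ∈ Finset.Nat.antidiagonalTuple k 1) (H : ℕ → α) :
    ∏ i, H (l i) = H 1 * H 0 ^ (k - 1) := by
  have hsum := Finset.Nat.mem_antidiagonalTuple.mp hl
  obtain ⟨i₀, -, hi₀⟩ := Finset.exists_ne_zero_of_sum_ne_zero (hsum.trans_ne one_ne_zero)
  rw [← Finset.add_sum_erase _ _ (Finset.mem_univ i₀)] at hsum
  have h0 : ∑ i ∈ Finset.univ.erase i₀, l i = 0 := by omega
  rw [← Finset.mul_prod_erase _ _ (Finset.mem_univ i₀), show l i₀ = 1 by omega]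
  congr 1
  rw [Finset.prod_congr rfl fun i hi => by rw [Finset.sum_eq_zero_iff.mp h0 i hi],
    Finset.prod_const, Finset.card_erase_of_mem (Finset.mem_univ _), Finset.card_univ,
    Fintype.card_fin]

section Iterates

variable {d k : ℕ} {F₀ F₁ : Edim d → ℂ} {N B : ℝ}

theorem SeparatedBound.Xi_one (hN : 0 < N) (hB : 0 ≤ B)
    (h0 : SeparatedBound (Xi d k F₀ F₁ 0)
      (fun t => ENNReal.ofReal (4 * (1 + B * Real.exp (-(N / 4) * t))))) :
    SeparatedBound (Xi d k F₀ F₁ 1)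
      (fun t => ENNReal.ofReal (4 * 8 ^ k * (t ^ 2 + t / N * ∑ m ∈ Finset.Icc 1 k, B ^ m))) := by
  refine (Xi_succ (j := 0)
    (H := fun _ t => ENNReal.ofReal (4 * (1 + B * Real.exp (-(N / 4) * t))))
    fun i hi => by rwa [Nat.le_zero.mp hi]).mono fun t ht => ?_
  set S := ∑ m ∈ Finset.Icc 1 k, B ^ m with hS
  have hS0 : 0 ≤ S := Finset.sum_nonneg fun m _ => by positivity
  have ht0 := ht.1
  rw [Finset.Nat.antidiagonalTuple_zero_right, Finset.sum_singleton]
  calc _ ≤ ENNReal.ofReal t *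
        ∫⁻ t' in Ioc 0 t, ENNReal.ofReal (8 ^ k + 8 ^ k * S * Real.exp (-(N / 4) * t')) := by
        refine mul_le_mul' le_rfl (setLIntegral_mono' measurableSet_Ioc fun t' ht' => ?_)
        rw [Finset.prod_const, Finset.card_univ, Fintype.card_fin,
          ← ENNReal.ofReal_pow (by positivity)]
        refine ENNReal.ofReal_le_ofReal ?_
        have h := one_add_mul_pow_le hB (Real.exp_pos (-(N / 4) * t')).le
          (Real.exp_le_one_iff.mpr (by nlinarith [ht'.1])) k
        calc _ = 4 ^ k * (1 + B * Real.exp (-(N / 4) * t')) ^ k := mul_pow _ _ _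
          _ ≤ 4 ^ k * (2 ^ k * (1 + S * Real.exp (-(N / 4) * t'))) := by gcongr
          _ = _ := by
            rw [show (8 : ℝ) = 4 * 2 by norm_num, mul_pow]
            ring
    _ ≤ ENNReal.ofReal t * ENNReal.ofReal (8 ^ k * t + 8 ^ k * S / (N / 4)) :=
        mul_le_mul' le_rfl
          (lintegral_ofReal_add_mul_exp_le (by positivity) (by positivity) (by positivity) ht0)
    _ ≤ _ := by
        rw [← ENNReal.ofReal_mul ht0]
        refine ENNReal.ofReal_le_ofReal ?_
        have : t * (8 ^ k * t + 8 ^ k * S / (N / 4)) = 8 ^ k * (t ^ 2 + 4 * (t / N * S)) := by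
          field_simp
        rw [this]
        have : 0 ≤ (8 : ℝ) ^ k * t ^ 2 := by positivity
        linarith

theorem SeparatedBound.Xi_two (hN : 0 < N) (hB : 0 ≤ B) {c : ℝ} (hc : 0 ≤ c)
    (h0 : SeparatedBound (Xi d k F₀ F₁ 0)
      (fun t => ENNReal.ofReal (4 * (1 + B * Real.exp (-(N / 4) * t)))))
    (h1 : SeparatedBound (Xi d k F₀ F₁ 1)
      (fun t => ENNReal.ofReal (c * (t ^ 2 + t / N * ∑ m ∈ Finset.Icc 1 k, B ^ m)))) :
    SeparatedBound (Xi d k F₀ F₁ 2)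
      (fun t => (Finset.Nat.antidiagonalTuple k 1).card •
        ENNReal.ofReal (c * 8 ^ (k - 1) * (t ^ 4 + t ^ 3 / N * ∑ m ∈ Finset.Icc 1 k, B ^ m +
          1024 * (t / N ^ 3) * ((∑ m ∈ Finset.Icc 1 (k - 1), B ^ m) +
            (∑ m ∈ Finset.Icc 1 k, B ^ m) * ∑ m ∈ Finset.Icc 1 (k - 1), B ^ m)))) := by
  set S := ∑ m ∈ Finset.Icc 1 k, B ^ m with hS
  set S' := ∑ m ∈ Finset.Icc 1 (k - 1), B ^ m with hS'
  have hS0 : 0 ≤ S := Finset.sum_nonneg fun m _ => by positivity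
  have hS'0 : 0 ≤ S' := Finset.sum_nonneg fun m _ => by positivity
  refine (Xi_succ (j := 1)
    (H := fun i t => if i = 0 then ENNReal.ofReal (4 * (1 + B * Real.exp (-(N / 4) * t)))
      else ENNReal.ofReal (c * (t ^ 2 + t / N * S)))
    fun i hi => ?_).mono fun t ht => ?_
  · rcases Nat.le_one_iff_eq_zero_or_eq_one.mp hi with rfl | rfl
    · simpa using h0
    · simpa using h1
  have ht0 := ht.1
  refine Finset.sum_le_card_nsmul _ _ _ fun l hl => ?_
  set D := c * 8 ^ (k - 1) with hD
  have hD0 : 0 ≤ D := by positivity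
  calc _ ≤ ENNReal.ofReal t *
        ∫⁻ t' in Ioc 0 t, ENNReal.ofReal (D * (t ^ 2 + t / N * S) +
          D * (128 / N ^ 2 * S' + 8 / N ^ 2 * (S * S')) * Real.exp (-(N / 8) * t')) := by
        refine mul_le_mul' le_rfl (setLIntegral_mono' measurableSet_Ioc fun t' ht' => ?_)
        rw [prod_apply_of_mem_antidiagonalTuple_one hl fun i => if i = 0 then
          ENNReal.ofReal (4 * (1 + B * Real.exp (-(N / 4) * t')))
            else ENNReal.ofReal (c * (t' ^ 2 + t' / N * S))]
        have ht'0 := ht'.1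
        simp only [one_ne_zero, if_false, if_true]
        rw [← ENNReal.ofReal_pow (by positivity), ← ENNReal.ofReal_mul (by positivity)]
        refine ENNReal.ofReal_le_ofReal ?_
        set E := Real.exp (-(N / 4) * t') with hE
        have h := one_add_mul_pow_le hB (Real.exp_pos (-(N / 4) * t')).le
          (Real.exp_le_one_iff.mpr (by nlinarith)) (k - 1)
        have e1 := mul_exp_le (a := N / 8) (x := t') (by positivity)
        have e2 := sq_mul_exp_le (a := N / 8) (x := t') (by positivity) ht'0.le
        rw [show -(2 * (N / 8)) * t' = -(N / 4) * t' by ring, ← hE] at e1 e2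
        set G := Real.exp (-(N / 8) * t') with hG
        calc c * (t' ^ 2 + t' / N * S) * (4 * (1 + B * E)) ^ (k - 1)
            ≤ c * (t' ^ 2 + t' / N * S) * (4 ^ (k - 1) * (2 ^ (k - 1) * (1 + S' * E))) := by
              rw [mul_pow]
              gcongr
          _ = D * ((t' ^ 2 + t' / N * S) + ((t' ^ 2 * E) * S' + 1 / N * (t' * E) * (S * S'))) := by
              rw [hD, show (8 : ℝ) = 4 * 2 by norm_num, mul_pow]
              ring
          _ ≤ D * ((t ^ 2 + t / N * S) + ((2 / (N / 8) ^ 2 * G) * S' +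
                1 / N * (1 / (N / 8) * G) * (S * S'))) := by
              gcongr
              exacts [ht'.2, ht'.2]
          _ = _ := by
              field_simp
              ring
    _ ≤ ENNReal.ofReal t * ENNReal.ofReal (D * (t ^ 2 + t / N * S) * t +
          D * (128 / N ^ 2 * S' + 8 / N ^ 2 * (S * S')) / (N / 8)) :=
        mul_le_mul' le_rfl
          (lintegral_ofReal_add_mul_exp_le (by positivity) (by positivity) (by positivity) ht0)
    _ ≤ _ := by
        rw [← ENNReal.ofReal_mul ht0]
        refine ENNReal.ofReal_le_ofReal ?_
        have : t * (D * (t ^ 2 + t / N * S) * t +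
            D * (128 / N ^ 2 * S' + 8 / N ^ 2 * (S * S')) / (N / 8)) =
            D * (t ^ 4 + t ^ 3 / N * S +
              (1024 * (t / N ^ 3) * S' + 64 * (t / N ^ 3) * (S * S'))) := by
          field_simp
          ring
        rw [this, mul_add (1024 * (t / N ^ 3))]
        gcongr
        norm_num

end Iterates

theorem second_iterate_size_le {k : ℕ} {N B t : ℝ} (hN : 0 < N) (hB : 0 ≤ B) (ht : 1 / N ≤ t) :
    t ^ 4 + t ^ 3 / N * ∑ m ∈ Finset.Icc 1 k, B ^ m +
      1024 * (t / N ^ 3) * ((∑ m ∈ Finset.Icc 1 (k - 1), B ^ m) +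
        (∑ m ∈ Finset.Icc 1 k, B ^ m) * ∑ m ∈ Finset.Icc 1 (k - 1), B ^ m) ≤
    1025 * (1 + (k : ℝ) ^ 2) * ((t / N) ^ 2 * (∑ m ∈ Finset.Icc (k + 1) (2 * k - 1), B ^ m) +
      t ^ 3 / N * (∑ m ∈ Finset.Icc 1 k, B ^ m) + t ^ 4) := by
  have hSS := sum_pow_mul_sum_pow_le hB k
  have hS' : ∑ m ∈ Finset.Icc 1 (k - 1), B ^ m ≤ ∑ m ∈ Finset.Icc 1 k, B ^ m :=
    Finset.sum_le_sum_of_subset_of_nonneg (Finset.Icc_subset_Icc_right (by omega))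
      fun m _ _ => by positivity
  have hS0 : 0 ≤ ∑ m ∈ Finset.Icc 1 k, B ^ m := Finset.sum_nonneg fun m _ => by positivity
  have hT0 : 0 ≤ ∑ m ∈ Finset.Icc (k + 1) (2 * k - 1), B ^ m :=
    Finset.sum_nonneg fun m _ => by positivity
  set S := ∑ m ∈ Finset.Icc 1 k, B ^ m
  set S' := ∑ m ∈ Finset.Icc 1 (k - 1), B ^ m
  set T := ∑ m ∈ Finset.Icc (k + 1) (2 * k - 1), B ^ m
  have ht0 : 0 < t := (by positivity : 0 < 1 / N).trans_le ht
  have h1 : t / N ^ 3 ≤ (t / N) ^ 2 := by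
    calc t / N ^ 3 = t / N ^ 2 * (1 / N) := by field_simp
      _ ≤ t / N ^ 2 * t := by gcongr
      _ = _ := by ring
  have h2 : t / N ^ 3 ≤ t ^ 3 / N := by
    calc t / N ^ 3 ≤ (t / N) ^ 2 := h1
      _ = t ^ 2 / N * (1 / N) := by ring
      _ ≤ t ^ 2 / N * t := by gcongr
      _ = _ := by ring
  calc _ ≤ t ^ 4 + t ^ 3 / N * S + 1024 * (t / N ^ 3) * (S + (k : ℝ) ^ 2 * (S + T)) := by gcongr
    _ = t ^ 4 + t ^ 3 / N * S + 1024 * ((1 + (k : ℝ) ^ 2) * (t / N ^ 3 * S) +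
          (k : ℝ) ^ 2 * (t / N ^ 3 * T)) := by ring
    _ ≤ t ^ 4 + t ^ 3 / N * S + 1024 * ((1 + (k : ℝ) ^ 2) * (t ^ 3 / N * S) +
          (k : ℝ) ^ 2 * ((t / N) ^ 2 * T)) := by gcongr
    _ ≤ _ := by
        have a1 : 0 ≤ t ^ 4 := by positivity
        have a2 : 0 ≤ t ^ 3 / N * S := by positivity
        have a3 : 0 ≤ (t / N) ^ 2 * T := by positivity
        nlinarith [mul_nonneg (sq_nonneg (k : ℝ)) a1, mul_nonneg (sq_nonneg (k : ℝ)) a2,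
          mul_nonneg (sq_nonneg (k : ℝ)) a3]

/-- Lemma 4.4: bounds on the first three Picard iterates at
`u⃗ = (u₀ + φ, u₁)`, with Schwartz `(u₀,u₁)` of unit size and `φ̂ = R·𝟙_{Ω_k}`,
in the time regime `N⁻¹ ≪ t ≪ 1`. -/
theorem first_three_iterates_bounds
    (d k : ℕ) (hd : 1 ≤ d) (hk : 2 ≤ k) (s : ℝ) (hs : s < 0) :
    ∃ C δ K : ℝ, 0 < C ∧ 0 < δ ∧ 0 < K ∧
      ∀ F₀ F₁ : SchwartzMap (Edim d) ℂ,
        pairFLNorm d ⇑F₀ ⇑F₁ ≤ 1 → pairHsNorm d 0 ⇑F₀ ⇑F₁ ≤ 1 →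
        ∀ A N R : ℝ, 1 ≤ A → A / δ ≤ N → 0 < R →
          ∀ t : ℝ, K / N ≤ t → t ≤ δ →
            HsNorm d s (Xi d k (fun ξ => F₀ ξ + phiHatK d k N A R ξ) ⇑F₁ 0 t) ≤
              ENNReal.ofReal (C * (R * N ^ s * A ^ ((d : ℝ) / 2) + 1)) ∧
            HsNorm d s (Xi d k (fun ξ => F₀ ξ + phiHatK d k N A R ξ) ⇑F₁ 1 t) ≤
              ENNReal.ofReal (C * ((t / N) * ∑ m ∈ Finset.Icc 1 k, R ^ m * A ^ (m * d)
                + t ^ 2)) ∧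
            HsNorm d s (Xi d k (fun ξ => F₀ ξ + phiHatK d k N A R ξ) ⇑F₁ 2 t) ≤
              ENNReal.ofReal (C * ((t / N) ^ 2 *
                  (∑ m ∈ Finset.Icc (k + 1) (2 * k - 1), R ^ m * A ^ (m * d))
                + (t ^ 3 / N) * (∑ m ∈ Finset.Icc 1 k, R ^ m * A ^ (m * d))
                + t ^ 4)) := by
  set n := (Finset.Nat.antidiagonalTuple k 1).card with hn
  have h2s : (0 : ℝ) < 2 ^ (-s) := by positivity
  refine ⟨4 + 2 * 2 ^ (-s) + 4 * 8 ^ k +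
    n * (4 * 8 ^ k * 8 ^ (k - 1) * (1025 * (1 + (k : ℝ) ^ 2))), 1, 1, by positivity, one_pos,
    one_pos, fun F₀ F₁ hFL hHs A N R hA hAN hR t hKt ht1 => ?_⟩
  rw [div_one] at hAN
  have hN : 0 < N := by linarith
  have ht : t ∈ Icc (0 : ℝ) 1 := ⟨(by positivity : 0 ≤ 1 / N).trans hKt, ht1⟩
  have ht0 := ht.1
  set B := R * A ^ d with hB
  have hB0 : 0 ≤ B := by positivity
  have hpow : ∀ m : ℕ, R ^ m * A ^ (m * d) = B ^ m := fun m => by rw [hB, mul_pow, ← pow_mul']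
  simp only [hpow]
  have hV := SeparatedBound.Vflow F₀.continuous.measurable F₁.continuous.measurable hFL hHs
  have h0 : SeparatedBound (Xi d k (fun ξ => F₀ ξ + phiHatK d k N A R ξ) ⇑F₁ 0)
      (fun t => ENNReal.ofReal (4 * (1 + B * Real.exp (-(N / 4) * t)))) := by
    rw [Xi]
    exact hV.Vflow_add_phiHatK hd k hA hAN hR.le
  have h1 := h0.Xi_one hN hB0
  have h2 := SeparatedBound.Xi_two hN hB0 (by positivity) h0 h1
  have hS0 : ∀ a b : ℕ, 0 ≤ ∑ m ∈ Finset.Icc a b, B ^ m := fun a b =>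
    Finset.sum_nonneg fun m _ => by positivity
  have hS1 := hS0 1 k
  have hS2 := hS0 (k + 1) (2 * k - 1)
  have hn0 : (0 : ℝ) ≤ n * (4 * 8 ^ k * 8 ^ (k - 1) * (1025 * (1 + (k : ℝ) ^ 2))) := by positivity
  have h8 : (0 : ℝ) ≤ 4 * 8 ^ k := by positivity
  refine ⟨?_, ?_, ?_⟩
  · rw [Xi]
    refine (HsNorm_Vflow_add_phiHatK_le hd k hV F₀.continuous.measurable F₁.continuous.measurable
      hs.le hA hAN hR.le ht).trans (ENNReal.ofReal_le_ofReal ?_)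
    have hX : 0 ≤ R * N ^ s * A ^ ((d : ℝ) / 2) := by positivity
    calc 4 + 2 * (N / 2) ^ s * (R * A ^ ((d : ℝ) / 2))
        = 4 * 1 + 2 * 2 ^ (-s) * (R * N ^ s * A ^ ((d : ℝ) / 2)) := by
          rw [Real.div_rpow hN.le zero_le_two, Real.rpow_neg zero_le_two]
          ring
      _ ≤ _ := by
          rw [mul_add]
          nlinarith
  · refine (h1.HsNorm_le hs.le ht).trans (ENNReal.ofReal_le_ofReal ?_)
    rw [add_comm (t ^ 2)]
    gcongr
    linarith
  · refine (h2.HsNorm_le hs.le ht).trans ?_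
    rw [← hn, nsmul_eq_mul, ← ENNReal.ofReal_natCast, ← ENNReal.ofReal_mul (by positivity)]
    refine ENNReal.ofReal_le_ofReal ?_
    refine (mul_le_mul_of_nonneg_left (mul_le_mul_of_nonneg_left
      (second_iterate_size_le hN hB0 hKt) (by positivity)) (by positivity)).trans ?_
    rw [← mul_assoc, ← mul_assoc, ← mul_assoc (n : ℝ)]
    gcongr
    linarith

end
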